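/- Let q be an odd prime power, χ the quadratic character on F_q, and f ∈ F_q[x] with f = ∏ p_i^{v_i} a product of L distinct monic irreducible polynomials of degree at most D, not all exponents v_i even. Then |∑_{x∈F_q} χ(f(x))| ≤ 2·L·D·√q. -/

import Mathlib

namespace WeilQ
open Polynomial

section A
variable {F : Type} [Field F]

lemma dvd_hasse (f : F[X]) (c : ℕ) : ∀ i, f ^ (c - i) ∣ hasseDeriv i (f ^ c) := by
  induction c with
  | zero => intro i; simp
  | succ c ih =>
    intro i
    rw [pow_succ', hasseDeriv_mul]
    apply Finset.dvd_sum
    rintro ⟨a, b⟩ hab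
    rw [Finset.HasAntidiagonal.mem_antidiagonal] at hab
    simp only at hab ⊢
    rcases Nat.eq_zero_or_pos a with h | h
    · subst h
      rw [hasseDeriv_zero']
      refine dvd_trans (pow_dvd_pow f (show c + 1 - i ≤ 1 + (c - b) by omega)) ?_
      rw [pow_add, pow_one]
      exact mul_dvd_mul_left _ (ih b)
    · refine dvd_mul_of_dvd_right (dvd_trans (pow_dvd_pow f ?_) (ih b)) _
      omega

lemma exists_w (f : F[X]) (hf : 1 ≤ f.natDegree) (c i : ℕ) (hi : i ≤ c) :
    ∃ w : F[X], f ^ i * hasseDeriv i (f ^ c) = f ^ c * w ∧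
      w.natDegree ≤ i * (f.natDegree - 1) := by
  obtain ⟨w, hw⟩ := dvd_hasse f c i
  have hf0 : f ≠ 0 := by rintro rfl; simp at hf
  refine ⟨w, ?_, ?_⟩
  · rw [hw, ← mul_assoc, ← pow_add]; congr 2; omega
  · by_cases h0 : w = 0
    · simp [h0]
    have h1 := natDegree_hasseDeriv_le (f ^ c) i
    rw [hw, natDegree_mul (pow_ne_zero _ hf0) h0, natDegree_pow, natDegree_pow] at h1
    obtain ⟨m, hm⟩ := Nat.exists_eq_add_of_le hf
    obtain ⟨e, rfl⟩ := Nat.exists_eq_add_of_le hi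
    rw [hm] at h1 ⊢
    simp only [Nat.add_sub_cancel_left] at h1 ⊢
    have : (i + e) * (1 + m) - i = e * (1 + m) + i * m := by
      rw [Nat.sub_eq_iff_eq_add (by nlinarith)]; ring
    omega

lemma exists_ker {W : Type} [AddCommGroup W] [Module F W] [FiniteDimensional F W]
    (M : ℕ) (N : ℕ → ℕ) (Z : ℕ → W →ₗ[F] F[X])
    (hZ : ∀ k < M, ∀ w, (Z k w).natDegree < N k)
    (hN : ∑ k ∈ Finset.range M, N k < Module.finrank F W) :
    ∃ w : W, w ≠ 0 ∧ ∀ k < M, Z k w = 0 := by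
  let T : W →ₗ[F] ((k : Fin M) → (Fin (N k) → F)) :=
    LinearMap.pi fun k => LinearMap.pi fun i => (lcoeff F (i : ℕ)) ∘ₗ (Z k)
  have hT : LinearMap.ker T ≠ ⊥ := by
    apply LinearMap.ker_ne_bot_of_finrank_lt
    rw [Module.finrank_pi_fintype]
    simpa [Fin.sum_univ_eq_sum_range] using hN
  obtain ⟨w, hw, hw0⟩ := (Submodule.ne_bot_iff _).1 hT
  refine ⟨w, hw0, fun k hk => ?_⟩
  ext i
  by_cases hi : i < N k
  · have := congrFun (congrFun (LinearMap.mem_ker.1 hw) ⟨k, hk⟩) ⟨i, hi⟩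
    simpa [T] using this
  · rw [coeff_eq_zero_of_natDegree_lt, coeff_zero]
    exact lt_of_lt_of_le (hZ k hk w) (not_lt.1 hi)

lemma dvd_of_hasse (r : F[X]) (x : F) (M : ℕ) (h : ∀ k < M, (hasseDeriv k r).eval x = 0) :
    (X - C x) ^ M ∣ r := by
  have h1 : (X : F[X]) ^ M ∣ taylor x r := by
    rw [X_pow_dvd_iff]
    intro d hd
    rw [taylor_coeff]; exact h d hd
  obtain ⟨s, hs⟩ := h1
  refine ⟨taylor (-x) s, ?_⟩
  have := congrArg (taylor (-x)) hs
  rw [taylor_taylor, taylor_mul, taylor_X_pow] at this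
  simpa [sub_eq_add_neg] using this

lemma card_mul_le (r : F[X]) (hr : r ≠ 0) (S : Finset F) (M : ℕ)
    (h : ∀ x ∈ S, (X - C x) ^ M ∣ r) : M * S.card ≤ r.natDegree := by
  classical
  have : M • S.val ≤ r.roots := by
    rw [Multiset.le_iff_count]
    intro x
    rw [Multiset.count_nsmul, count_roots]
    by_cases hx : x ∈ S
    · have h1 : Multiset.count x S.val = 1 := Multiset.count_eq_one_of_mem S.nodup hx
      rw [h1, mul_one]
      exact (le_rootMultiplicity_iff hr).2 (h x hx)
    · have h1 : Multiset.count x S.val = 0 := Multiset.count_eq_zero_of_notMem hx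
      rw [h1]; simp
  have h2 := Multiset.card_le_card this
  rw [Multiset.card_nsmul] at h2
  exact le_trans h2 (card_roots' r)

lemma sq_descent (f : F[X]) (hsq : Squarefree f) (hf : 1 ≤ f.natDegree) (b : F) (hb : b ≠ 0)
    (u v : F[X]) (h : f * u ^ 2 = C b * v ^ 2) : u = 0 ∧ v = 0 := by
  have hf0 : f ≠ 0 := by rintro rfl; simp at hf
  have key : u = 0 := by
    by_contra hu
    have hv : v ≠ 0 := by
      rintro rfl
      have : f * u ^ 2 = 0 := by rw [h]; simp
      exact (mul_ne_zero hf0 (pow_ne_zero _ hu)) this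
    have hnu : ¬ IsUnit f := fun hh => by
      have := natDegree_eq_zero_of_isUnit hh; omega
    obtain ⟨π, hπ, hd⟩ := WfDvdMonoid.exists_irreducible_factor hnu hf0
    have hp : Prime π := hπ.prime
    have hfin : ∀ g : F[X], g ≠ 0 → FiniteMultiplicity π g := fun g hg =>
      FiniteMultiplicity.of_prime_left hp hg
    have h1 : multiplicity π f = 1 := by
      have := (squarefree_iff_emultiplicity_le_one f).1 hsq π
      have h3 : ¬ π ^ 2 ∣ f := by
        intro hh
        rw [pow_two] at hh
        exact hπ.not_isUnit (hsq π hh)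
      exact multiplicity_eq_of_dvd_of_not_dvd (by simpa using hd) h3
    have h2 : multiplicity π (f * u ^ 2) = multiplicity π (C b * v ^ 2) := by rw [h]
    have hCb : multiplicity π (C b) = 0 := by
      apply multiplicity_eq_zero.2
      intro hh
      exact hπ.not_isUnit (isUnit_of_dvd_unit hh (isUnit_C.2 hb.isUnit))
    rw [multiplicity_mul hp (hfin _ (mul_ne_zero hf0 (pow_ne_zero _ hu))),
      multiplicity_mul hp (hfin _ (mul_ne_zero (by simpa using hb) (pow_ne_zero _ hv))),
      (hfin u hu).multiplicity_pow hp, (hfin v hv).multiplicity_pow hp, h1, hCb] at h2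
    omega
  refine ⟨key, ?_⟩
  subst key
  have : v ^ 2 = 0 := by simpa [hb] using h.symm
  simpa using this

lemma digit_split (q n J : ℕ) (p : ℕ → F[X]) (h0 : ∀ i < n, p i = 0) (hJ : ∀ i, J ≤ i → p i = 0) :
    ∃ R : F[X], ∑ j ∈ Finset.range J, p j * X ^ (q * j) = X ^ (q * n) * (p n + X ^ q * R) := by
  have : X ^ (q * (n + 1)) ∣ ∑ j ∈ Finset.range (J + n + 1), p j * X ^ (q * j) - p n * X ^ (q * n) := by
    rw [← Finset.sum_erase_add _ _ (Finset.mem_range.2 (show n < J + n + 1 by omega)),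
      add_sub_cancel_right]
    apply Finset.dvd_sum
    intro j hj
    rw [Finset.mem_erase] at hj
    rcases lt_or_gt_of_ne hj.1 with h | h
    · rw [h0 j h]; simp
    · exact dvd_mul_of_dvd_right (pow_dvd_pow _ (Nat.mul_le_mul_left q h)) _
  obtain ⟨R, hR⟩ := this
  refine ⟨R, ?_⟩
  have h2 : ∑ j ∈ Finset.range (J + n + 1), p j * X ^ (q * j)
      = ∑ j ∈ Finset.range J, p j * X ^ (q * j) := by
    symm
    apply Finset.sum_subset
    · intro x; simp only [Finset.mem_range]; omega
    · intro x _ hx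
      rw [hJ x (by simpa using hx), zero_mul]
  rw [← h2, sub_eq_iff_eq_add.1 hR]; ring

end A

section B
variable {F : Type} [Field F] [Fintype F]

lemma nonvanish (q c A J : ℕ) (hq : Fintype.card F = q) (hc : q = 2 * c + 1)
    (f : F[X]) (hsq : Squarefree f) (hf : 1 ≤ f.natDegree) (hf0 : f.eval 0 ≠ 0)
    (hA : 2 * A + f.natDegree < q)
    (u v : ℕ → F[X]) (hu : ∀ i, (u i).natDegree ≤ A) (hv : ∀ i, (v i).natDegree ≤ A)
    (huJ : ∀ i, J ≤ i → u i = 0) (hvJ : ∀ i, J ≤ i → v i = 0)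
    (h : ∑ j ∈ Finset.range J, u j * X ^ (q * j)
      + f ^ c * ∑ j ∈ Finset.range J, v j * X ^ (q * j) = 0) :
    ∀ n, u n = 0 ∧ v n = 0 := by
  intro n
  induction n using Nat.strong_induction_on with
  | _ n ih =>
  obtain ⟨R, hR⟩ := digit_split q n J u (fun i hi => (ih i hi).1) huJ
  obtain ⟨S, hS⟩ := digit_split q n J v (fun i hi => (ih i hi).2) hvJ
  rw [hR, hS] at h
  have hX : (X : F[X]) ^ (q * n) ≠ 0 := pow_ne_zero _ X_ne_zero
  have h1 : (u n + X ^ q * R) = - (f ^ c * (v n + X ^ q * S)) := by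
    apply mul_left_cancel₀ hX
    linear_combination h
  have hex : expand F q f = f ^ q := by
    rw [← hq]; exact FiniteField.expand_card f
  have h2 : f * (u n + X ^ q * R) ^ 2 = expand F q f * (v n + X ^ q * S) ^ 2 := by
    rw [h1, hex, hc]; ring
  have h3 : X ^ q ∣ expand F q f - C (f.eval 0) := by
    have : X ∣ f - C (f.eval 0) := by
      rw [X_dvd_iff]; simp [coeff_zero_eq_eval_zero]
    obtain ⟨g, hg⟩ := this
    refine ⟨expand F q g, ?_⟩
    have := congrArg (expand F q) hg
    simpa using this
  obtain ⟨G, hG⟩ := h3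
  have h4 : X ^ q ∣ f * u n ^ 2 - C (f.eval 0) * v n ^ 2 := by
    rw [sub_eq_iff_eq_add.1 hG] at h2
    refine ⟨G * (v n + X ^ q * S) ^ 2 + C (f.eval 0) * (2 * v n * S + X ^ q * S ^ 2)
      - f * (2 * u n * R + X ^ q * R ^ 2), ?_⟩
    linear_combination h2
  have h5 : f * u n ^ 2 - C (f.eval 0) * v n ^ 2 = 0 := by
    by_contra hne
    have := natDegree_le_of_dvd h4 hne
    rw [natDegree_X_pow] at this
    have h6 := natDegree_sub_le (f * u n ^ 2) (C (f.eval 0) * v n ^ 2)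
    have h7 : (f * u n ^ 2).natDegree ≤ f.natDegree + 2 * A :=
      le_trans natDegree_mul_le (by
        have := natDegree_pow_le (p := u n) (n := 2)
        have := hu n; omega)
    have h8 : (C (f.eval 0) * v n ^ 2).natDegree ≤ 2 * A :=
      le_trans (natDegree_C_mul_le _ _) (by
        have := natDegree_pow_le (p := v n) (n := 2)
        have := hv n; omega)
    have := max_le (h7.trans (by omega : _ ≤ f.natDegree + 2 * A)) (h8.trans (by omega : _ ≤ f.natDegree + 2 * A))
    omega
  exact sq_descent f hsq hf _ hf0 _ _ (sub_eq_zero.1 h5)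

end B

section C
variable {F : Type} [Field F]

/-- `p ↦ f^k * D^k p`. -/
noncomputable def Pk (f : F[X]) (k : ℕ) : F[X] →ₗ[F] F[X] :=
  LinearMap.mulLeft F (f ^ k) ∘ₗ hasseDeriv k

/-- `f^k * D^k (f^c p) = f^c * Qk p`. -/
noncomputable def Qk (f : F[X]) (w : ℕ → F[X]) (k : ℕ) : F[X] →ₗ[F] F[X] :=
  ∑ ab ∈ Finset.HasAntidiagonal.antidiagonal k, LinearMap.mulLeft F (w ab.1) ∘ₗ Pk f ab.2

lemma Pk_apply (f : F[X]) (k : ℕ) (p : F[X]) : Pk f k p = f ^ k * hasseDeriv k p := rfl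

lemma Pk_deg (f : F[X]) (hf : 1 ≤ f.natDegree) (k A : ℕ) (p : F[X]) (hp : p.natDegree ≤ A) :
    (Pk f k p).natDegree ≤ A + k * (f.natDegree - 1) := by
  rw [Pk_apply]
  by_cases h : p.natDegree < k
  · rw [hasseDeriv_eq_zero_of_lt_natDegree _ _ h]; simp
  refine natDegree_mul_le.trans ?_
  have h1 := natDegree_hasseDeriv_le p k
  have h2 := natDegree_pow_le (p := f) (n := k)
  obtain ⟨m, hm⟩ := Nat.exists_eq_add_of_le hf
  rw [hm] at h2 ⊢
  rw [Nat.add_sub_cancel_left]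
  have : k * (1 + m) = k + k * m := by ring
  omega

lemma Qk_deg (f : F[X]) (hf : 1 ≤ f.natDegree) (w : ℕ → F[X]) (k A : ℕ)
    (hw : ∀ i ≤ k, (w i).natDegree ≤ i * (f.natDegree - 1))
    (p : F[X]) (hp : p.natDegree ≤ A) :
    (Qk f w k p).natDegree ≤ A + k * (f.natDegree - 1) := by
  rw [Qk, LinearMap.sum_apply]
  apply natDegree_sum_le_of_forall_le
  rintro ⟨a, b⟩ hab
  rw [Finset.HasAntidiagonal.mem_antidiagonal] at hab
  simp only at hab
  simp only [LinearMap.comp_apply, LinearMap.mulLeft_apply]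
  refine natDegree_mul_le.trans ?_
  have h1 := Pk_deg f hf b A p hp
  have h2 := hw a (by omega)
  have : k * (f.natDegree - 1) = a * (f.natDegree - 1) + b * (f.natDegree - 1) := by
    rw [← hab]; ring
  omega

lemma Qk_spec (f : F[X]) (c : ℕ) (w : ℕ → F[X]) (k : ℕ)
    (hw : ∀ i ≤ k, f ^ i * hasseDeriv i (f ^ c) = f ^ c * w i) (p : F[X]) :
    f ^ k * hasseDeriv k (f ^ c * p) = f ^ c * Qk f w k p := by
  rw [Qk, LinearMap.sum_apply, hasseDeriv_mul, Finset.mul_sum, Finset.mul_sum]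
  apply Finset.sum_congr rfl
  rintro ⟨a, b⟩ hab
  rw [Finset.HasAntidiagonal.mem_antidiagonal] at hab
  simp only at hab
  simp only [LinearMap.comp_apply, LinearMap.mulLeft_apply, Pk_apply]
  have := hw a (by omega)
  rw [← hab, pow_add]
  linear_combination (f ^ b * hasseDeriv b p) * this

/-- The polynomial whose vanishing makes the `k`-th derivative vanish. -/
noncomputable def Zk (f : F[X]) (w : ℕ → F[X]) (a : F) (J1 J2 k : ℕ) (u v : ℕ → F[X]) : F[X] :=
  ∑ j ∈ Finset.range J1, X ^ j * Pk f k (u j) +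
    a • ∑ j ∈ Finset.range J2, X ^ j * Qk f w k (v j)

lemma Zk_deg (f : F[X]) (hf : 1 ≤ f.natDegree) (w : ℕ → F[X]) (a : F) (J1 J2 k A : ℕ)
    (hw : ∀ i ≤ k, (w i).natDegree ≤ i * (f.natDegree - 1)) (hJ : J2 ≤ J1)
    (u v : ℕ → F[X]) (hu : ∀ i, (u i).natDegree ≤ A) (hv : ∀ i, (v i).natDegree ≤ A) :
    (Zk f w a J1 J2 k u v).natDegree ≤ A + k * (f.natDegree - 1) + (J1 - 1) := by
  unfold Zk
  apply natDegree_add_le_of_degree_le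
  · apply natDegree_sum_le_of_forall_le
    intro j hj
    rw [Finset.mem_range] at hj
    refine natDegree_mul_le.trans ?_
    have := Pk_deg f hf k A (u j) (hu j)
    rw [natDegree_X_pow]; omega
  · refine (natDegree_smul_le _ _).trans ?_
    apply natDegree_sum_le_of_forall_le
    intro j hj
    rw [Finset.mem_range] at hj
    refine natDegree_mul_le.trans ?_
    have := Qk_deg f hf w k A hw (v j) (hv j)
    rw [natDegree_X_pow]; omega

end C

section D
variable {F : Type} [Field F] [Fintype F]

lemma mult_at (q c M J1 J2 : ℕ) (hq : Fintype.card F = q) (hM : M ≤ q) (hc : 0 < c)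
    (f : F[X]) (w : ℕ → F[X])
    (hw : ∀ i < M, f ^ i * hasseDeriv i (f ^ c) = f ^ c * w i)
    (a : F) (ha : a ≠ 0) (u v : ℕ → F[X]) (hZ : ∀ k < M, Zk f w a J1 J2 k u v = 0)
    (x : F) (hx : f.eval x ^ c = a) :
    (X - C x) ^ M ∣ ∑ j ∈ Finset.range J1, u j * X ^ (q * j)
      + f ^ c * ∑ j ∈ Finset.range J2, v j * X ^ (q * j) := by
  have hfx : f.eval x ≠ 0 := by
    intro h; rw [h, zero_pow hc.ne'] at hx; exact ha hx.symm
  have hXq : (X - C x) ^ q = X ^ q - C x := by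
    rw [← hq, ← FiniteField.expand_card]; simp
  have hXj : ∀ j, (X - C x) ^ M ∣ X ^ (q * j) - C (x ^ j) := by
    intro j
    refine (pow_dvd_pow _ hM).trans ?_
    rw [hXq, pow_mul, C_pow]
    exact sub_dvd_pow_sub_pow _ _ _
  set r0 : F[X] := ∑ j ∈ Finset.range J1, C (x ^ j) * u j
      + ∑ j ∈ Finset.range J2, C (x ^ j) * (f ^ c * v j) with hr0
  have h1 : (X - C x) ^ M ∣ (∑ j ∈ Finset.range J1, u j * X ^ (q * j)
      + f ^ c * ∑ j ∈ Finset.range J2, v j * X ^ (q * j)) - r0 := by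
    rw [hr0, Finset.mul_sum, add_sub_add_comm, ← Finset.sum_sub_distrib, ← Finset.sum_sub_distrib]
    apply dvd_add
    · apply Finset.dvd_sum
      intro j _
      obtain ⟨g, hg⟩ := hXj j
      exact ⟨g * u j, by linear_combination u j * hg⟩
    · apply Finset.dvd_sum
      intro j _
      obtain ⟨g, hg⟩ := hXj j
      exact ⟨g * (f ^ c * v j), by linear_combination (f ^ c * v j) * hg⟩
  refine (dvd_iff_dvd_of_dvd_sub h1).2 ?_
  apply dvd_of_hasse
  intro k hk
  apply (mul_eq_zero.1 (?_ : f.eval x ^ k * _ = 0)).resolve_left (pow_ne_zero _ hfx)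
  have h2 := congrArg (eval x) (hZ k hk)
  have hP : f.eval x ^ k * eval x (hasseDeriv k r0) = eval x (f ^ k * hasseDeriv k r0) := by simp
  rw [hP, ← eval_zero (x := x), ← hZ k hk, hr0, Zk, map_add, map_sum, map_sum]
  simp only [C_mul', map_smul, mul_add, Finset.mul_sum, mul_smul_comm]
  simp only [Qk_spec f c w k (fun i hi => hw i (by omega)), eval_add, eval_finsetSum, eval_smul,
    eval_mul, eval_pow, hx, Pk_apply, eval_X, smul_eq_mul, Finset.mul_sum]
  congr 1
  apply Finset.sum_congr rfl
  intro j _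
  ring

end D
section D2
variable {F : Type} [Field F]

/-- Extend a finite family of bounded-degree polynomials by zero. -/
noncomputable def ext0 {n J : ℕ} (u : Fin J → degreeLT F n) (j : ℕ) : F[X] :=
  if h : j < J then (u ⟨j, h⟩ : F[X]) else 0

lemma ext0_deg {A J : ℕ} (u : Fin J → degreeLT F (A + 1)) (j : ℕ) :
    (ext0 u j).natDegree ≤ A := by
  unfold ext0
  split_ifs with h
  · have := mem_degreeLT.1 (u ⟨j, h⟩).2
    exact natDegree_le_iff_degree_le.2 (Order.lt_succ_iff.1 this)
  · simp

end D2
section D3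
variable {F : Type} [Field F] [Fintype F]

lemma count_le (q c M A J1 J2 h : ℕ) (hq : Fintype.card F = q) (hc : q = 2 * c + 1)
    (hM : M ≤ c) (hc0 : 0 < c) (hJ : J1 = J2 + h) (hJ1 : 1 ≤ J1)
    (f : F[X]) (hsq : Squarefree f) (hf : 1 ≤ f.natDegree) (hf0 : f.eval 0 ≠ 0)
    (hA : 2 * A + f.natDegree < q) (hh : f.natDegree * c ≤ h * q)
    (hdim : ∑ k ∈ Finset.range M, (A + k * (f.natDegree - 1) + (J1 - 1) + 1)
      < (J1 + J2) * (A + 1))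
    (a : F) (ha : a ≠ 0) (S : Finset F) (hS : ∀ x ∈ S, f.eval x ^ c = a) :
    M * S.card ≤ A + (J1 - 1) * q := by
  have hwex : ∀ i, ∃ w : F[X], i ≤ c → (f ^ i * hasseDeriv i (f ^ c) = f ^ c * w ∧
      w.natDegree ≤ i * (f.natDegree - 1)) := by
    intro i
    by_cases hi : i ≤ c
    · obtain ⟨w, hw⟩ := exists_w f hf c i hi
      exact ⟨w, fun _ => hw⟩
    · exact ⟨0, fun h => absurd h hi⟩
  choose w hw using hwex
  let W := (Fin J1 → degreeLT F (A + 1)) × (Fin J2 → degreeLT F (A + 1))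
  let Z : ℕ → W →ₗ[F] F[X] := fun k =>
    (∑ j : Fin J1, LinearMap.mulLeft F (X ^ (j : ℕ)) ∘ₗ Pk f k ∘ₗ (degreeLT F (A + 1)).subtype
      ∘ₗ LinearMap.proj j) ∘ₗ LinearMap.fst F _ _ +
    a • (∑ j : Fin J2, LinearMap.mulLeft F (X ^ (j : ℕ)) ∘ₗ Qk f w k ∘ₗ
      (degreeLT F (A + 1)).subtype ∘ₗ LinearMap.proj j) ∘ₗ LinearMap.snd F _ _
  have hZ : ∀ k (y : W), Z k y = Zk f w a J1 J2 k (ext0 y.1) (ext0 y.2) := by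
    intro k y
    simp only [Z, Zk, ← Fin.sum_univ_eq_sum_range (fun j => X ^ j * Pk f k (ext0 y.1 j)),
      ← Fin.sum_univ_eq_sum_range (fun j => X ^ j * Qk f w k (ext0 y.2 j))]
    simp [ext0]
    rfl
  have : FiniteDimensional F (degreeLT F (A + 1)) :=
    Module.Finite.equiv (degreeLTEquiv F (A + 1)).symm
  have hfr : Module.finrank F (degreeLT F (A + 1)) = A + 1 := by
    rw [(degreeLTEquiv F (A + 1)).finrank_eq]; simp
  have hfW : Module.finrank F W = (J1 + J2) * (A + 1) := by
    rw [Module.finrank_prod, Module.finrank_pi_fintype, Module.finrank_pi_fintype]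
    simp [hfr]; ring
  obtain ⟨y, hy0, hy⟩ := exists_ker M _ Z (fun k hk y => by
    rw [hZ, Nat.lt_succ_iff]
    exact Zk_deg f hf w a J1 J2 k A (fun i hi => (hw i (by omega)).2) (by omega) _ _
      (ext0_deg _) (ext0_deg _)) (by rw [hfW]; exact hdim)
  set u := ext0 y.1 with hu
  set v := ext0 y.2 with hv
  set r : F[X] := ∑ j ∈ Finset.range J1, u j * X ^ (q * j)
      + f ^ c * ∑ j ∈ Finset.range J2, v j * X ^ (q * j) with hr
  have huJ : ∀ i, J1 ≤ i → u i = 0 := fun i hi => by simp [hu, ext0, not_lt.2 hi]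
  have hvJ : ∀ i, J2 ≤ i → v i = 0 := fun i hi => by simp [hv, ext0, not_lt.2 hi]
  have hr0 : r ≠ 0 := by
    intro h0
    have h2 : ∑ j ∈ Finset.range J2, v j * X ^ (q * j)
        = ∑ j ∈ Finset.range J1, v j * X ^ (q * j) := by
      apply Finset.sum_subset
      · intro x; simp only [Finset.mem_range]; omega
      · intro x _ hx
        rw [hvJ x (by simpa using hx), zero_mul]
    rw [hr, h2] at h0
    have key := nonvanish q c A J1 hq hc f hsq hf hf0 hA u v (ext0_deg _) (ext0_deg _) huJ
      (fun i hi => hvJ i (by omega)) h0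
    apply hy0
    ext j : 2
    · ext1
      have := (key j).1
      simpa [hu, ext0] using this
    · ext1
      have := (key j).2
      simpa [hv, ext0] using this
  have hmul : ∀ x ∈ S, (X - C x) ^ M ∣ r := fun x hx =>
    mult_at q c M J1 J2 hq (by omega) hc0 f w (fun i hi => (hw i (by omega)).1) a ha u v
      (fun k hk => by rw [← hZ]; exact hy k hk) x (hS x hx)
  refine (card_mul_le r hr0 S M hmul).trans ?_
  have hmono : ∀ j < J1, q * j ≤ (J1 - 1) * q := fun j hj => by
    rw [mul_comm]; exact Nat.mul_le_mul_right q (by omega)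
  rw [hr]
  apply natDegree_add_le_of_degree_le
  · apply natDegree_sum_le_of_forall_le
    intro j hj
    rw [Finset.mem_range] at hj
    refine natDegree_mul_le.trans ?_
    rw [natDegree_X_pow]
    exact Nat.add_le_add (ext0_deg _ _) (hmono j hj)
  · rw [Finset.mul_sum]
    apply natDegree_sum_le_of_forall_le
    intro j hj
    rw [Finset.mem_range] at hj
    refine natDegree_mul_le.trans ?_
    have h1 : (v j * X ^ (q * j)).natDegree ≤ A + q * j := by
      refine natDegree_mul_le.trans ?_
      rw [natDegree_X_pow]
      exact Nat.add_le_add (ext0_deg _ _) le_rfl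
    have h2 : (f ^ c).natDegree ≤ h * q := by
      rw [natDegree_pow, mul_comm]; exact hh
    have h3 := hmono (j + h) (by omega)
    have : q * (j + h) = q * j + h * q := by ring
    omega

end D3

section E

lemma arith_small : ∀ q ∈ List.range 196, ∀ m ∈ List.range 7, 2 ≤ m → 4 * m ^ 2 < q → q % 2 = 1 →
    ∃ M ∈ List.range 12, 1 ≤ M ∧ M ≤ (q - 1) / 2 ∧ (M + m) % 2 = 1 ∧ (q + M - 1) ^ 2 ≤ 4 * q * M ^ 2 ∧
      m * M ^ 2 < (q - m) * (m / 2 + 1) := by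
  decide +kernel

lemma arith (q m : ℕ) (hm : 2 ≤ m) (hq : 4 * m ^ 2 < q) (hodd : q % 2 = 1) :
    ∃ M, 1 ≤ M ∧ M ≤ (q - 1) / 2 ∧ (M + m) % 2 = 1 ∧
      ((q : ℝ) + M - 1 ≤ 2 * Real.sqrt q * M) ∧
      m * M ^ 2 < (q - m) * (m / 2 + 1) := by
  by_cases hs : q < 196
  · have hm7 : m < 7 := by nlinarith
    obtain ⟨M, -, h1, h2, h3, h4, h5⟩ := arith_small q (by simpa using hs) m (by simpa using hm7) hm hq hodd
    refine ⟨M, h1, h2, h3, ?_, h5⟩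
    have h6 : (((q + M - 1 : ℕ) : ℝ)) ^ 2 ≤ 4 * q * M ^ 2 := by exact_mod_cast h4
    rw [Nat.cast_sub (by omega)] at h6
    push_cast at h6
    refine le_trans (le_abs_self _) (abs_le_of_sq_le_sq ?_ (by positivity))
    rw [mul_pow, mul_pow, Real.sq_sqrt (by positivity)]
    linarith
  · push Not at hs
    set t := Nat.sqrt q with ht
    have ht1 : t ^ 2 ≤ q := by rw [pow_two]; exact Nat.sqrt_le q
    have ht2 : q < (t + 1) ^ 2 := by rw [pow_two]; exact Nat.lt_succ_sqrt q
    obtain ⟨M, hM1, hM2, hM3⟩ : ∃ M, t + 3 ≤ 2 * M ∧ 2 * M ≤ t + 6 ∧ (M + m) % 2 = 1 := by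
      by_cases h : (t / 2 + 2 + m) % 2 = 1
      · exact ⟨t / 2 + 2, by omega, by omega, h⟩
      · exact ⟨t / 2 + 3, by omega, by omega, by omega⟩
    set s := Real.sqrt q with hsdef
    have hs2 : s ^ 2 = q := Real.sq_sqrt (by positivity)
    have hs0 : 0 ≤ s := Real.sqrt_nonneg _
    have hs14 : 14 ≤ s := by
      apply Real.le_sqrt_of_sq_le
      have : (196 : ℝ) ≤ q := by exact_mod_cast hs
      linarith
    have hts : (t : ℝ) ≤ s := by
      apply Real.le_sqrt_of_sq_le; exact_mod_cast ht1
    have hst : s < t + 1 := by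
      rw [hsdef, Real.sqrt_lt' (by positivity)]; exact_mod_cast ht2
    have hsm : 2 * (m : ℝ) ≤ s := by
      apply Real.le_sqrt_of_sq_le
      have : (4 * m ^ 2 : ℝ) < q := by exact_mod_cast hq
      nlinarith
    have hMa : s + 2 ≤ 2 * (M : ℝ) := by
      have : (t : ℝ) + 3 ≤ 2 * M := by exact_mod_cast hM1
      linarith
    have hMb : 2 * (M : ℝ) ≤ s + 6 := by
      have : 2 * (M : ℝ) ≤ t + 6 := by exact_mod_cast hM2
      linarith
    have hm' : (2 : ℝ) ≤ m := by exact_mod_cast hm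
    have hmq : m ≤ q := by nlinarith
    refine ⟨M, by omega, ?_, hM3, ?_, ?_⟩
    · have : 2 * M + 1 ≤ q := by
        have : 2 * (M : ℝ) + 1 ≤ q := by nlinarith
        exact_mod_cast this
      omega
    · rw [← hs2]; nlinarith
    · have h1 : 2 * (m * M ^ 2) < (q - m) * (m + 1) := by
        have : 2 * ((m : ℝ) * M ^ 2) < (q - m) * (m + 1) := by
          have hM4 : 4 * (M : ℝ) ^ 2 ≤ s ^ 2 + 12 * s + 36 := by nlinarith
          have a1 : (m : ℝ) * (4 * (M : ℝ) ^ 2) ≤ m * (s ^ 2 + 12 * s + 36) :=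
            mul_le_mul_of_nonneg_left hM4 (by linarith)
          have a2 : 0 ≤ (m : ℝ) * (s ^ 2 / 2 - 4.5 * s - 19 - 16) := by
            apply mul_nonneg (by linarith); nlinarith
          have a3 : (2 * m : ℝ) * s ≤ s * s := mul_le_mul_of_nonneg_right hsm hs0
          have a4 : (m : ℝ) * (2 * m) ≤ m * s := mul_le_mul_of_nonneg_left hsm (by linarith)
          rw [← hs2]
          nlinarith
        zify [hmq]
        exact_mod_cast this
      have h2 : m + 1 ≤ 2 * (m / 2 + 1) := by omega
      have h3 : (q - m) * (m + 1) ≤ (q - m) * (2 * (m / 2 + 1)) := Nat.mul_le_mul_left _ h2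
      have h4 : (q - m) * (2 * (m / 2 + 1)) = 2 * ((q - m) * (m / 2 + 1)) := by ring
      omega

lemma sum_arith (B d M : ℕ) :
    2 * ∑ k ∈ Finset.range M, (B + k * d) + d * M = 2 * M * B + d * M * M := by
  induction M with
  | zero => simp
  | succ n ih => rw [Finset.sum_range_succ]; linarith

end E

section G
variable {F : Type} [Field F] [Fintype F] [DecidableEq F]

lemma core (q : ℕ) (hq : Fintype.card F = q) (hodd : q % 2 = 1)
    (f : F[X]) (hsq : Squarefree f) (hf : 2 ≤ f.natDegree) (hf0 : f.eval 0 ≠ 0)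
    (hlarge : 4 * f.natDegree ^ 2 < q) :
    |∑ x : F, ((quadraticChar F (f.eval x) : ℤ) : ℝ)| ≤ 2 * f.natDegree * Real.sqrt q := by
  set m := f.natDegree with hm
  obtain ⟨M, hM1, hMc, hpar, hreal, hdim⟩ := arith q m hf hlarge hodd
  have hch : ringChar F ≠ 2 := by
    intro h
    have := FiniteField.even_card_of_char_two h
    omega
  have hmq : m ≤ q := by nlinarith
  have hmq' : m + 1 ≤ q := by nlinarith
  have hcount : ∀ a : F, a ≠ 0 →
      M * (Finset.univ.filter fun x : F => f.eval x ^ (q / 2) = a).card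
        ≤ (q - m - 1) / 2 + ((M + m + 1) / 2 - 1) * q := by
    intro a ha
    refine count_le q (q / 2) M ((q - m - 1) / 2) ((M + m + 1) / 2)
      ((M + m + 1) / 2 - (m + 1) / 2) ((m + 1) / 2) hq (by omega) (by omega) (by omega)
      (by omega) (by omega) f hsq (by omega) hf0 (by omega) ?_ ?_ a ha _ (by simp)
    · rw [← hm]
      have h1 : m * (q / 2) ≤ (2 * ((m + 1) / 2)) * (q / 2) := Nat.mul_le_mul_right _ (by omega)
      have h2 : (m + 1) / 2 * (2 * (q / 2)) ≤ (m + 1) / 2 * q := Nat.mul_le_mul_left _ (by omega)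
      nlinarith
    · rw [← hm]
      obtain ⟨A, hA⟩ : ∃ A, A = (q - m - 1) / 2 := ⟨_, rfl⟩
      obtain ⟨J, hJ⟩ : ∃ J, J = (M + m + 1) / 2 := ⟨_, rfl⟩
      obtain ⟨E, hE⟩ : ∃ E, E = m / 2 + 1 := ⟨_, rfl⟩
      have e1 : J + (J - (m + 1) / 2) = M + E := by omega
      rw [← hA, ← hJ, e1]
      have e2 : ∑ k ∈ Finset.range M, (A + k * (m - 1) + (J - 1) + 1)
          = ∑ k ∈ Finset.range M, (A + J + k * (m - 1)) := by
        apply Finset.sum_congr rfl; intro k _; omega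
      rw [e2]
      have e3 := sum_arith (A + J) (m - 1) M
      rw [← hE] at hdim
      have e4 : (q - m) * E ≤ 2 * (A + 1) * E := Nat.mul_le_mul_right _ (by omega)
      have e5 : 2 * J = M + m + 1 := by omega
      obtain ⟨d, hd⟩ : ∃ d, m = d + 1 := ⟨m - 1, by omega⟩
      have hd' : m - 1 = d := by omega
      rw [hd'] at e3 ⊢
      have e6 : 2 * M * J = M * (M + d + 2) := by
        rw [mul_assoc, mul_left_comm, e5, hd]; ring
      rw [hd] at hdim e4
      nlinarith
  have hb : ∀ a : F, a ≠ 0 → 2 * (M : ℝ) * (Finset.univ.filter fun x : F => f.eval x ^ (q / 2) = a).card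
      ≤ (M + m) * q - m - 1 := by
    intro a ha
    have h1 := hcount a ha
    have h2 : 2 * (M * (Finset.univ.filter fun x : F => f.eval x ^ (q / 2) = a).card) + m + 1
        ≤ (M + m) * q := by
      have h3 : 2 * ((q - m - 1) / 2) + m + 1 ≤ q := by omega
      have h4 : 2 * ((M + m + 1) / 2 - 1) + 1 = M + m := by omega
      rw [← h4]
      nlinarith
    have h3 : 2 * ((M : ℝ) * (Finset.univ.filter fun x : F => f.eval x ^ (q / 2) = a).card) + m + 1
        ≤ (M + m) * q := by exact_mod_cast h2
    linarith
  have hN0 : ((Finset.univ.filter fun x : F => f.eval x = 0).card : ℝ) ≤ m := by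
    have hf00 : f ≠ 0 := by rintro rfl; simp at hf0
    have := card_mul_le f hf00 (Finset.univ.filter fun x : F => f.eval x = 0) 1 (by
      intro x hx
      rw [pow_one, dvd_iff_isRoot]
      simpa using hx)
    rw [one_mul] at this
    exact_mod_cast this
  have hpt : ∀ ε : ℤ, (ε = 1 ∨ ε = -1) → ∀ x : F,
      ((ε * quadraticChar F (f.eval x) : ℤ) : ℝ) ≤
        2 * (if f.eval x ^ (q / 2) = (ε : F) then 1 else 0) + (if f.eval x = 0 then 1 else 0) - 1 := by
    intro ε hε x
    by_cases h0 : f.eval x = 0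
    · rw [h0]
      simp only [MulChar.map_zero, mul_zero, Int.cast_zero, if_true]
      split_ifs <;> norm_num
    · have h1 := quadraticChar_eq_pow_of_char_ne_two' hch (f.eval x)
      rw [hq] at h1
      rw [← h1, if_neg h0]
      rcases quadraticChar_dichotomy h0 with h | h <;> rcases hε with rfl | rfl <;> rw [h] <;>
        norm_num <;> split_ifs <;> norm_num
  have hsum : ∀ ε : ℤ, (ε = 1 ∨ ε = -1) →
      (ε : ℝ) * ∑ x : F, ((quadraticChar F (f.eval x) : ℤ) : ℝ) ≤ 2 * m * Real.sqrt q := by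
    intro ε hε
    have h1 := Finset.sum_le_sum (fun x (_ : x ∈ (Finset.univ : Finset F)) => hpt ε hε x)
    rw [Finset.sum_sub_distrib, Finset.sum_add_distrib, ← Finset.mul_sum, Finset.sum_boole,
      Finset.sum_boole, Finset.sum_const, Finset.card_univ, hq] at h1
    have h2 := hb (ε : F) (by rcases hε with rfl | rfl <;> simp)
    have h3 : (ε : ℝ) * ∑ x : F, ((quadraticChar F (f.eval x) : ℤ) : ℝ)
        = ∑ x : F, ((ε * quadraticChar F (f.eval x) : ℤ) : ℝ) := by
      rw [Finset.mul_sum]; push_cast; rfl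
    rw [← h3] at h1
    set S := (ε : ℝ) * ∑ x : F, ((quadraticChar F (f.eval x) : ℤ) : ℝ)
    set N := ((Finset.univ.filter fun x : F => f.eval x ^ (q / 2) = (ε : F)).card : ℝ)
    have hMpos : (0 : ℝ) < M := by exact_mod_cast hM1
    have hmpos : (0 : ℝ) ≤ m := by positivity
    simp only [nsmul_eq_mul, mul_one] at h1
    have h4 : S ≤ 2 * N + m - q := by linarith
    have h5 : M * S ≤ M * (2 * N + m - q) := mul_le_mul_of_nonneg_left h4 hMpos.le
    have h6 : (m : ℝ) * (q + M - 1) ≤ m * (2 * Real.sqrt q * M) :=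
      mul_le_mul_of_nonneg_left hreal hmpos
    have h7 : M * S ≤ M * (2 * m * Real.sqrt q) := by nlinarith
    exact le_of_mul_le_mul_left h7 hMpos
  rw [abs_le]
  have a1 := hsum 1 (Or.inl rfl)
  have a2 := hsum (-1) (Or.inr rfl)
  push_cast at a1 a2
  constructor <;> linarith

end G

section H
variable {F : Type} [Field F] [Fintype F] [DecidableEq F]

lemma abs_char_le (y : F) : |((quadraticChar F y : ℤ) : ℝ)| ≤ 1 := by
  by_cases h : y = 0
  · simp [h]
  · rcases quadraticChar_dichotomy h with h | h <;> rw [h] <;> norm_num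

lemma squarefree_bound (q : ℕ) (hq : Fintype.card F = q) (hodd : q % 2 = 1)
    (f : F[X]) (hmon : f.Monic) (hsq : Squarefree f) (hf : 1 ≤ f.natDegree) :
    |∑ x : F, ((quadraticChar F (f.eval x) : ℤ) : ℝ)| ≤ 2 * f.natDegree * Real.sqrt q := by
  have hch : ringChar F ≠ 2 := by
    intro h
    have := FiniteField.even_card_of_char_two h
    omega
  by_cases h1 : f.natDegree = 1
  · have h2 : f = X + C (f.coeff 0) := by
      have := hmon.as_sum
      rw [h1] at this
      simpa using this
    have h3 : ∑ x : F, ((quadraticChar F (f.eval x) : ℤ) : ℝ) = 0 := by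
      rw [h2]
      simp only [eval_add, eval_X, eval_C]
      rw [Fintype.sum_equiv (Equiv.addRight (f.coeff 0)) _
        (fun y : F => ((quadraticChar F y : ℤ) : ℝ)) (fun x => by simp)]
      have := quadraticChar_sum_zero hch
      exact_mod_cast this
    rw [h3, abs_zero]; positivity
  by_cases hl : 4 * f.natDegree ^ 2 < q
  · have hex : ∃ a : F, f.eval a ≠ 0 := by
      by_contra hne
      push Not at hne
      have := card_mul_le f hmon.ne_zero (Finset.univ : Finset F) 1 (by
        intro x _
        rw [pow_one, dvd_iff_isRoot]
        exact hne x)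
      rw [one_mul, Finset.card_univ, hq] at this
      nlinarith
    obtain ⟨a, ha⟩ := hex
    have hsq' : Squarefree (taylor a f) := by
      intro y hy
      obtain ⟨z, hz⟩ := hy
      have h4 := congrArg (taylor (-a)) hz
      rw [taylor_taylor, taylor_mul, taylor_mul] at h4
      simp only [neg_add_cancel, taylor_zero] at h4
      have h5 := hsq (taylor (-a) y) ⟨_, h4⟩
      have h6 := h5.map (taylorAlgHom a)
      have h7 : taylorAlgHom a (taylor (-a) y) = y := by
        change taylor a (taylor (-a) y) = y
        rw [taylor_taylor]; simp
      rwa [h7] at h6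
    have := core q hq hodd (taylor a f) hsq' (by rw [natDegree_taylor]; omega)
      (by rw [taylor_eval]; simpa using ha) (by rw [natDegree_taylor]; exact hl)
    rw [natDegree_taylor] at this
    simp only [taylor_eval] at this
    rwa [Fintype.sum_equiv (Equiv.addRight a) _
        (fun y : F => ((quadraticChar F (f.eval y) : ℤ) : ℝ)) (fun x => by simp)] at this
  · refine (Finset.abs_sum_le_sum_abs _ _).trans ?_
    refine (Finset.sum_le_sum fun x _ => abs_char_le (f.eval x)).trans ?_
    rw [Finset.sum_const, Finset.card_univ, hq, nsmul_eq_mul, mul_one]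
    have h2 : (q : ℝ) ≤ 4 * (f.natDegree : ℝ) ^ 2 := by exact_mod_cast not_lt.1 hl
    have h3 : Real.sqrt q ≤ 2 * f.natDegree := by
      apply Real.sqrt_le_iff.2 ⟨by positivity, by linarith⟩
    have h4 : Real.sqrt q * Real.sqrt q = q := Real.mul_self_sqrt (by positivity)
    nlinarith [Real.sqrt_nonneg q]

end H
end WeilQ

/-- **Weil-type bound.** For `f = ∏ pᵢ^{vᵢ}` a product of `L` distinct
monic irreducibles of degree at most `D` with not all exponents even,
`|∑_{x∈F_q} χ(f(x))| ≤ 2·L·D·√q`, where `χ` is the quadratic character. -/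
theorem quadratic_char_sum_weil_bound
    (q L D : ℕ) (F : Type) [Field F] [Fintype F] [DecidableEq F]
    (hq : Fintype.card F = q) (hodd : Odd q)
    (hpp : ∃ p k : ℕ, p.Prime ∧ 0 < k ∧ q = p ^ k)
    (p : Fin L → Polynomial F) (hmon : ∀ i, (p i).Monic)
    (hirr : ∀ i, Irreducible (p i)) (hdist : Function.Injective p)
    (hD : ∀ i, (p i).natDegree ≤ D)
    (v : Fin L → ℕ) (hv : ¬ ∀ i, Even (v i))
    (f : Polynomial F) (hf : f = ∏ i, (p i) ^ (v i)) :
    |∑ x : F, ((quadraticChar F (f.eval x) : ℤ) : ℝ)|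
      ≤ 2 * (L : ℝ) * (D : ℝ) * Real.sqrt q := by
  classical
  set O : Finset (Fin L) := Finset.univ.filter fun i => ¬ Even (v i) with hO
  set E : Finset (Fin L) := Finset.univ.filter fun i => Even (v i) with hE
  set g : Polynomial F := ∏ i ∈ O, p i with hg
  set h : Polynomial F := ∏ i, p i ^ (v i / 2) with hh
  have hfg : f = g * h ^ 2 := by
    rw [hf, hg, hh, hO, Finset.prod_filter, ← Finset.prod_pow, ← Finset.prod_mul_distrib]
    apply Finset.prod_congr rfl
    intro i _
    split_ifs with he
    · rw [one_mul, ← pow_mul]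
      congr 1
      have := Nat.even_iff.1 he
      omega
    · rw [← pow_mul, ← pow_succ']
      congr 1
      have := Nat.not_even_iff.1 he
      omega
  have hgmon : g.Monic := Polynomial.monic_prod_of_monic _ _ fun i _ => hmon i
  have hgdeg : g.natDegree = ∑ i ∈ O, (p i).natDegree :=
    Polynomial.natDegree_prod_of_monic _ _ fun i _ => hmon i
  have hgle : g.natDegree ≤ O.card * D := by
    rw [hgdeg]
    simpa using Finset.sum_le_card_nsmul O _ D fun i _ => hD i
  have hgpos : 1 ≤ g.natDegree := by
    push Not at hv
    obtain ⟨i, hi⟩ := hv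
    have hiO : i ∈ O := Finset.mem_filter.2 ⟨Finset.mem_univ _, hi⟩
    rw [hgdeg]
    exact (hirr i).natDegree_pos.trans_le
      (Finset.single_le_sum (f := fun i => (p i).natDegree) (fun _ _ => Nat.zero_le _) hiO)
  have hgsq : Squarefree g := by
    apply Finset.squarefree_prod_of_pairwise_isCoprime
    · intro i _ j _ hij
      refine ((hirr i).coprime_iff_not_dvd.2 ?_ : IsCoprime (p i) (p j)).isRelPrime
      intro hdvd
      apply hij
      apply hdist
      exact Polynomial.eq_of_monic_of_associated (hmon i) (hmon j)
        ((hirr i).associated_of_dvd (hirr j) hdvd)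
    · intro i _
      exact (hirr i).squarefree
  have hS := WeilQ.squarefree_bound q hq (Nat.odd_iff.1 hodd) g hgmon hgsq hgpos
  -- the exceptional set
  set B : Finset F := E.biUnion fun i => (p i).roots.toFinset with hB
  have hBcard : B.card ≤ E.card * D := by
    refine Finset.card_biUnion_le_card_mul _ _ _ fun i _ => ?_
    exact (Multiset.toFinset_card_le _).trans ((Polynomial.card_roots' _).trans (hD i))
  have hpt : ∀ x : F, |((quadraticChar F (f.eval x) : ℤ) : ℝ)
      - ((quadraticChar F (g.eval x) : ℤ) : ℝ)| ≤ if x ∈ B then 1 else 0 := by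
    intro x
    rw [hfg, Polynomial.eval_mul, Polynomial.eval_pow, map_mul]
    by_cases hx : h.eval x = 0
    · rw [hx]
      by_cases hgx : g.eval x = 0
      · rw [hgx]; simp; split_ifs <;> norm_num
      · have hxB : x ∈ B := by
          rw [hh, Polynomial.eval_prod, Finset.prod_eq_zero_iff] at hx
          obtain ⟨i, _, hi⟩ := hx
          rw [Polynomial.eval_pow] at hi
          have hi' : (p i).eval x = 0 := eq_zero_of_pow_eq_zero hi
          rw [hB, Finset.mem_biUnion]
          refine ⟨i, ?_, ?_⟩
          · by_contra hiE
            apply hgx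
            rw [hg, Polynomial.eval_prod]
            refine Finset.prod_eq_zero (i := i) ?_ hi'
            simpa [hO, hE] using hiE
          · rw [Multiset.mem_toFinset, Polynomial.mem_roots (hmon i).ne_zero]
            exact hi'
        rw [if_pos hxB]
        simpa using WeilQ.abs_char_le (g.eval x)
    · rw [quadraticChar_sq_one' hx]
      simp; split_ifs <;> norm_num
  have hdiff : |∑ x : F, ((quadraticChar F (f.eval x) : ℤ) : ℝ)
      - ∑ x : F, ((quadraticChar F (g.eval x) : ℤ) : ℝ)| ≤ E.card * D := by
    rw [← Finset.sum_sub_distrib]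
    refine (Finset.abs_sum_le_sum_abs _ _).trans ?_
    refine (Finset.sum_le_sum fun x _ => hpt x).trans ?_
    rw [Finset.sum_boole]
    have : (Finset.univ.filter fun x => x ∈ B) = B := by ext; simp
    rw [this]
    exact_mod_cast hBcard
  have hLcard : (L : ℝ) = O.card + E.card := by
    have := Finset.card_filter_add_card_filter_not (s := (Finset.univ : Finset (Fin L)))
      (fun i => Even (v i))
    rw [Finset.card_univ, Fintype.card_fin] at this
    have h2 : O.card + E.card = L := by rw [hO, hE]; omega
    exact_mod_cast h2.symm
  have hs1 : 1 ≤ Real.sqrt q := by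
    apply Real.one_le_sqrt.2
    have : 1 ≤ q := hodd.pos
    exact_mod_cast this
  have hgle' : (g.natDegree : ℝ) ≤ O.card * D := by exact_mod_cast hgle
  have t1 : 2 * (g.natDegree : ℝ) * Real.sqrt q ≤ 2 * (O.card * D) * Real.sqrt q := by gcongr
  have t2 : ((E.card : ℝ) * D) * 1 ≤ (E.card * D) * Real.sqrt q := by gcongr
  have t3 : 0 ≤ ((E.card : ℝ) * D) * Real.sqrt q := by positivity
  have t4 := abs_sub_abs_le_abs_sub (∑ x : F, ((quadraticChar F (f.eval x) : ℤ) : ℝ))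
    (∑ x : F, ((quadraticChar F (g.eval x) : ℤ) : ℝ))
  rw [hLcard]
  nlinarith
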